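/- Fix integers n ≥ 1 and s > 1 and let □^n_{(s)} denote the s-skeleton of the standard cube □^{{1,…,n}}. Then CrSeq^d(□^n_{(s)}) = ∅ whenever s−1 does not divide d, and for every q ≥ 0, CrSeq^{q(s−1)}(□^n_{(s)}) equals the set of all pairs ((E_j)_{j=1}^q, (F_j)_{j=0}^q) of sequences of subsets with {1,…,n} = E_1 ⊔ … ⊔ E_q ⊔ F_0 ⊔ … ⊔ F_q such that #E_j = s+1 for every j and, for every j, F_{j−1} = ∅ or max F_{j−1} < max E_j. -/

import Mathlib

section Core

variable {A : Type*} [DecidableEq A] [Fintype A]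

/-- A cube of the standard `A`-cube: `none` means `*`, `some true` means `1`,
`some false` means `0`. -/
abbrev Cube (A : Type*) := A → Option Bool

/-- The cube `c(O, S, rest)` with value `1` on `O`, `*` on `S` and `0` elsewhere. -/
def cubeOn (O S : Finset A) : Cube A := fun a =>
  if a ∈ S then none else if a ∈ O then some true else some false

/-- An `A`-cubical complex: a set of cubes closed under the face maps, i.e. under
replacing any occurrence of `*` by `0` or `1`. -/
def IsComplex (K : Set (Cube A)) : Prop :=
  ∀ c ∈ K, ∀ a : A, c a = none → ∀ ε : Bool, Function.update c a (some ε) ∈ K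

/-- Union of the blocks of a list of finsets. -/
def blocksUnion (L : List (Finset A)) : Finset A := L.foldr (· ∪ ·) ∅

/-- `L` is an ordered partition of `S`: a sequence of nonempty pairwise disjoint
subsets whose union is `S`. -/
def IsOPart (S : Finset A) (L : List (Finset A)) : Prop :=
  (∀ B ∈ L, B.Nonempty) ∧
    List.Pairwise (fun B C : Finset A => Disjoint B C) L ∧ blocksUnion L = S

/-- The set `P_K` of ordered partitions `L = B₁|…|B_l` of `S` such that each cube
`c((O ∪ B₁∪…∪B_{i-1}), B_i, rest)` belongs to `K`.  Here `O` records the part of the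
ambient set on which the cubes take the fixed value `1` (used for the restrictions
`K|_B^ε`); for the full complex take `O = ∅`, `S = univ`. -/
def PK (K : Set (Cube A)) (O S : Finset A) : Set (List (Finset A)) :=
  {L | IsOPart S L ∧ ∀ (i : ℕ) (h : i < L.length),
    cubeOn (O ∪ blocksUnion (L.take i)) (L[i]'h) ∈ K}

/-- `x` refines `y`: the blocks of `y` are obtained by uniting consecutive blocks of `x`. -/
def Refines (x y : List (Finset A)) : Prop :=
  ∃ LL : List (List (Finset A)), (∀ l ∈ LL, l ≠ []) ∧
    x = LL.flatten ∧ y = LL.map blocksUnion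

/-- Dimension of an ordered partition: `Σ (#Bᵢ - 1)`. -/
def pdim (L : List (Finset A)) : ℕ := (L.map fun B => B.card - 1).sum

/-- The facet relation on ordered partitions. -/
def PFacet (x y : List (Finset A)) : Prop :=
  Refines x y ∧ x ≠ y ∧ pdim y = pdim x + 1

/-- A cycle of a discrete vector field on a poset of ordered partitions. -/
def PCycle (V : Set (List (Finset A) × List (Finset A))) (k : ℕ)
    (a : Fin (k + 1) → List (Finset A)) (b : Fin k → List (Finset A)) : Prop :=
  0 < k ∧ a 0 = a (Fin.last k) ∧
    ∀ i : Fin k, (a i.castSucc, b i) ∈ V ∧ (a i.succ, b i) ∉ V ∧ PFacet (a i.succ) (b i)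

/-- A discrete vector field on ordered partitions is a gradient field if it has no cycle. -/
def PGradient (V : Set (List (Finset A) × List (Finset A))) : Prop :=
  ∀ k a b, ¬ PCycle V k a b

/-- Critical cells of a discrete vector field `V` on the set of cells `S`. -/
def CritOn (S : Set (List (Finset A)))
    (V : Set (List (Finset A) × List (Finset A))) : Set (List (Finset A)) :=
  {x | x ∈ S ∧ ∀ p ∈ V, p.1 ≠ x ∧ p.2 ≠ x}

end Core
section CrSeq

variable {A : Type*} [LinearOrder A] [Fintype A]

/-- `τ_B = b₁|b₂|…|b_l` for `B = {b₁ < … < b_l}`. -/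
def tauL (B : Finset A) : List (Finset A) :=
  (B.sort (· ≤ ·)).map fun a => ({a} : Finset A)

/-- `κ_B = b_l | {b₁,…,b_{l-1}}` for `B = {b₁ < … < b_l}` (junk value `[]` if `B = ∅`). -/
def kappaL (B : Finset A) : List (Finset A) :=
  if h : B.Nonempty then [({B.max' h} : Finset A), B.erase (B.max' h)] else []

/-- The critical cell `σ((E_j),(F_j)) = τ_{F₀}|κ_{E₁}|τ_{F₁}|…|κ_{E_q}|τ_{F_q}`. -/
def sigmaCell (q : ℕ) (E : Fin q → Finset A) (F : Fin (q + 1) → Finset A) :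
    List (Finset A) :=
  tauL (F 0) ++ (List.ofFn fun j : Fin q => kappaL (E j) ++ tauL (F j.succ)).flatten

/-- `C_j = F₀ ∪ E₁ ∪ F₁ ∪ … ∪ E_{j-1} ∪ F_{j-1}` (here `j : Fin q` denotes the
paper's index `j+1 ∈ {1,…,q}`). -/
def CsetOf (q : ℕ) (E : Fin q → Finset A) (F : Fin (q + 1) → Finset A)
    (j : Fin q) : Finset A :=
  (Finset.univ.biUnion fun i : Fin q => if (i : ℕ) < (j : ℕ) then E i else ∅) ∪
    Finset.univ.biUnion fun i : Fin (q + 1) => if (i : ℕ) ≤ (j : ℕ) then F i else ∅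

/-- `((E_j)_{j=1}^q, (F_j)_{j=0}^q)` is a critical sequence in the `A`-cubical
complex `K`. -/
def IsCrSeq (K : Set (Cube A)) (q : ℕ) (E : Fin q → Finset A)
    (F : Fin (q + 1) → Finset A) : Prop :=
  (∀ x y : Fin q ⊕ Fin (q + 1), x ≠ y →
    Disjoint (Sum.elim E F x) (Sum.elim E F y)) ∧
  (∀ a : A, (∃ j, a ∈ E j) ∨ ∃ j, a ∈ F j) ∧
  sigmaCell q E F ∈ PK K ∅ Finset.univ ∧
  (∀ j : Fin q, F j.castSucc = ∅ ∨ (F j.castSucc).max < (E j).max) ∧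
  ∀ j : Fin q, cubeOn (CsetOf q E F j) (E j) ∉ K

/-- The dimension `Σ_j (#E_j - 2)` of a critical sequence. -/
def crDim (q : ℕ) (E : Fin q → Finset A) : ℕ := ∑ j : Fin q, ((E j).card - 2)

end CrSeq

/-- The set of directions (`*`-entries) of a cube. -/
def starSet {A : Type*} [Fintype A] (c : Cube A) : Finset A :=
  Finset.univ.filter fun a => c a = none

section Blocks

variable {A : Type*}

theorem mem_blocksUnion [DecidableEq A] {L : List (Finset A)} {a : A} :
    a ∈ blocksUnion L ↔ ∃ B ∈ L, a ∈ B := by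
  induction L with
  | nil => simp [blocksUnion]
  | cons B L ih =>
    have h : blocksUnion (B :: L) = B ∪ blocksUnion L := rfl
    simp [h, ih]

theorem starSet_cubeOn [DecidableEq A] [Fintype A] (O S : Finset A) :
    starSet (cubeOn O S) = S := by
  ext a
  rw [starSet, Finset.mem_filter, cubeOn]
  split_ifs <;> simp_all

theorem crDim_of_card_eq {s q : ℕ} {E : Fin q → Finset A}
    (hE : ∀ j, (E j).card = s + 1) : crDim q E = q * (s - 1) := by
  simp [crDim, hE]

variable [LinearOrder A]

theorem mem_tauL {S B : Finset A} : B ∈ tauL S ↔ ∃ a ∈ S, B = {a} := by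
  simp [tauL, eq_comm]

theorem pairwise_disjoint_tauL (S : Finset A) :
    (tauL S).Pairwise fun B C : Finset A => Disjoint B C := by
  rw [tauL, List.pairwise_map]
  refine (S.sort_nodup (· ≤ ·)).imp fun {a b} h => ?_
  simpa using h

theorem kappaL_of_nonempty {S : Finset A} (h : S.Nonempty) :
    kappaL S = [{S.max' h}, S.erase (S.max' h)] := by
  simp [kappaL, h]

theorem subset_of_mem_kappaL {S B : Finset A} (hB : B ∈ kappaL S) : B ⊆ S := by
  by_cases h : S.Nonempty
  · rw [kappaL_of_nonempty h] at hB
    rcases List.mem_pair.1 hB with rfl | rfl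
    · simpa using S.max'_mem h
    · exact Finset.erase_subset _ _
  · simp [kappaL, h] at hB

theorem pairwise_disjoint_kappaL (S : Finset A) :
    (kappaL S).Pairwise fun B C : Finset A => Disjoint B C := by
  by_cases h : S.Nonempty <;> simp [kappaL, h]

theorem exists_mem_kappaL {S : Finset A} {a : A} (ha : a ∈ S) : ∃ B ∈ kappaL S, a ∈ B := by
  have h : S.Nonempty := ⟨a, ha⟩
  rw [kappaL_of_nonempty h]
  by_cases e : a = S.max' h
  · exact ⟨{S.max' h}, by simp, by simpa using e⟩
  · exact ⟨S.erase (S.max' h), by simp, Finset.mem_erase.2 ⟨e, ha⟩⟩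

theorem exists_mem_tauL {S : Finset A} {a : A} (ha : a ∈ S) : ∃ B ∈ tauL S, a ∈ B :=
  ⟨{a}, mem_tauL.2 ⟨a, ha, rfl⟩, by simp⟩

theorem subset_of_mem_tauL {S B : Finset A} (hB : B ∈ tauL S) : B ⊆ S := by
  obtain ⟨a, ha, rfl⟩ := mem_tauL.1 hB
  simpa using ha

theorem mem_sigmaCell {q : ℕ} {E : Fin q → Finset A} {F : Fin (q + 1) → Finset A}
    {B : Finset A} :
    B ∈ sigmaCell q E F ↔ (∃ j, B ∈ kappaL (E j)) ∨ ∃ j, B ∈ tauL (F j) := by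
  simp only [sigmaCell, List.mem_append, List.mem_flatten, List.mem_ofFn, Fin.exists_fin_succ]
  constructor
  · rintro (h | ⟨_, ⟨j, rfl⟩, h⟩)
    · exact .inr (.inl h)
    · rcases List.mem_append.1 h with h | h
      · exact .inl ⟨j, h⟩
      · exact .inr (.inr ⟨j, h⟩)
  · rintro (⟨j, h⟩ | h | ⟨j, h⟩)
    · exact .inr ⟨_, ⟨j, rfl⟩, List.mem_append_left _ h⟩
    · exact .inl h
    · exact .inr ⟨_, ⟨j, rfl⟩, List.mem_append_right _ h⟩

theorem pairwise_disjoint_sigmaCell {q : ℕ} {E : Fin q → Finset A}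
    {F : Fin (q + 1) → Finset A}
    (hEF : ∀ x y : Fin q ⊕ Fin (q + 1), x ≠ y →
      Disjoint (Sum.elim E F x) (Sum.elim E F y)) :
    (sigmaCell q E F).Pairwise fun B C : Finset A => Disjoint B C := by
  have hEE : ∀ i j, i ≠ j → Disjoint (E i) (E j) := fun i j h =>
    hEF (.inl i) (.inl j) (by simpa using h)
  have hFF : ∀ i j, i ≠ j → Disjoint (F i) (F j) := fun i j h =>
    hEF (.inr i) (.inr j) (by simpa using h)
  have hE_F : ∀ i j, Disjoint (E i) (F j) := fun i j => hEF (.inl i) (.inr j) (by simp)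
  rw [sigmaCell, List.pairwise_append, List.pairwise_flatten, List.pairwise_ofFn]
  refine ⟨pairwise_disjoint_tauL _, ⟨?_, ?_⟩, ?_⟩
  · intro l hl
    obtain ⟨j, rfl⟩ := (List.mem_ofFn' _ _).1 hl
    exact List.pairwise_append.2 ⟨pairwise_disjoint_kappaL _, pairwise_disjoint_tauL _,
      fun B hB C hC => (hE_F _ _).mono (subset_of_mem_kappaL hB) (subset_of_mem_tauL hC)⟩
  · intro i j hij B hB C hC
    rcases List.mem_append.1 hB with hB | hB <;> rcases List.mem_append.1 hC with hC | hC
    · exact (hEE _ _ hij.ne).mono (subset_of_mem_kappaL hB) (subset_of_mem_kappaL hC)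
    · exact (hE_F _ _).mono (subset_of_mem_kappaL hB) (subset_of_mem_tauL hC)
    · exact (hE_F _ _).symm.mono (subset_of_mem_tauL hB) (subset_of_mem_kappaL hC)
    · exact (hFF _ _ (by simpa using hij.ne)).mono (subset_of_mem_tauL hB)
        (subset_of_mem_tauL hC)
  · intro B hB C hC
    obtain ⟨l, hl, hC⟩ := List.mem_flatten.1 hC
    obtain ⟨j, rfl⟩ := (List.mem_ofFn' _ _).1 hl
    rcases List.mem_append.1 hC with hC | hC
    · exact (hE_F _ _).symm.mono (subset_of_mem_tauL hB) (subset_of_mem_kappaL hC)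
    · exact (hFF _ _ (Fin.succ_ne_zero j).symm).mono (subset_of_mem_tauL hB)
        (subset_of_mem_tauL hC)

variable [Fintype A]

theorem mem_PK_skeleton {s : ℕ} {O S : Finset A} {L : List (Finset A)} :
    L ∈ PK {c : Cube A | (starSet c).card ≤ s} O S ↔
      IsOPart S L ∧ ∀ B ∈ L, B.card ≤ s := by
  simp [PK, starSet_cubeOn, List.forall_mem_iff_getElem]

/-- Critical sequences in the `s`-skeleton of the standard cube. -/
theorem isCrSeq_skeleton_iff {s : ℕ} (hs : 1 < s) {q : ℕ} {E : Fin q → Finset A}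
    {F : Fin (q + 1) → Finset A} :
    IsCrSeq {c : Cube A | (starSet c).card ≤ s} q E F ↔
      (∀ x y : Fin q ⊕ Fin (q + 1), x ≠ y →
        Disjoint (Sum.elim E F x) (Sum.elim E F y)) ∧
      (∀ a : A, (∃ j, a ∈ E j) ∨ ∃ j, a ∈ F j) ∧
      (∀ j : Fin q, (E j).card = s + 1) ∧
      ∀ j : Fin q, F j.castSucc = ∅ ∨ (F j.castSucc).max < (E j).max := by
  simp only [IsCrSeq, mem_PK_skeleton, Set.mem_ofPred_eq, starSet_cubeOn, not_le]
  constructor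
  · rintro ⟨hdisj, hcov, ⟨-, hcard⟩, hmax, hlarge⟩
    refine ⟨hdisj, hcov, fun j => ?_, hmax⟩
    have hj := hlarge j
    have hne : (E j).Nonempty := Finset.card_pos.1 (by omega)
    have h := hcard ((E j).erase ((E j).max' hne))
      (mem_sigmaCell.2 (.inl ⟨j, by simp [kappaL_of_nonempty hne]⟩))
    rw [Finset.card_erase_of_mem (Finset.max'_mem _ hne)] at h
    omega
  · rintro ⟨hdisj, hcov, hcard, hmax⟩
    have hblock : ∀ B ∈ sigmaCell q E F, B.Nonempty ∧ B.card ≤ s := by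
      intro B hB
      rw [← Finset.card_pos]
      rcases mem_sigmaCell.1 hB with ⟨j, hj⟩ | ⟨j, hj⟩
      · have hc := hcard j
        have hne : (E j).Nonempty := Finset.card_pos.1 (by omega)
        rw [kappaL_of_nonempty hne] at hj
        rcases List.mem_pair.1 hj with rfl | rfl
        · rw [Finset.card_singleton]
          omega
        · rw [Finset.card_erase_of_mem (Finset.max'_mem _ hne)]
          omega
      · obtain ⟨a, -, rfl⟩ := mem_tauL.1 hj
        rw [Finset.card_singleton]
        omega
    refine ⟨hdisj, hcov, ⟨⟨fun B hB => (hblock B hB).1, pairwise_disjoint_sigmaCell hdisj, ?_⟩,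
      fun B hB => (hblock B hB).2⟩, hmax, fun j => by rw [hcard j]; omega⟩
    refine Finset.eq_univ_iff_forall.2 fun a => mem_blocksUnion.2 ?_
    rcases hcov a with ⟨j, hj⟩ | ⟨j, hj⟩
    · obtain ⟨B, hB, ha⟩ := exists_mem_kappaL hj
      exact ⟨B, mem_sigmaCell.2 (.inl ⟨j, hB⟩), ha⟩
    · obtain ⟨B, hB, ha⟩ := exists_mem_tauL hj
      exact ⟨B, mem_sigmaCell.2 (.inr ⟨j, hB⟩), ha⟩

end Blocks

/-- Let `□^n_{(s)}` (`s > 1`, `n ≥ 1`) be the `s`-skeleton of the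
standard cube `□^{{1,…,n}}`, i.e. the complex of cubes of dimension `≤ s`. Then
`CrSeq^d(□^n_{(s)}) = ∅` whenever `s-1 ∤ d`, and for every `q ≥ 0`,
`CrSeq^{q(s-1)}(□^n_{(s)})` consists exactly of the pairs `((E_j)_{j=1}^q,(F_j)_{j=0}^q)`
partitioning `{1,…,n}` with `#E_j = s+1` for all `j` and `F_{j-1} = ∅` or
`max F_{j-1} < max E_j` for all `j`. -/
theorem stmt_19 (n s : ℕ) (hn : 1 ≤ n) (hs : 1 < s) :
    (∀ d : ℕ, ¬ (s - 1) ∣ d →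
      {x : Σ q : ℕ, (Fin q → Finset (Fin n)) × (Fin (q + 1) → Finset (Fin n)) |
        IsCrSeq {c : Cube (Fin n) | (starSet c).card ≤ s} x.1 x.2.1 x.2.2 ∧
          crDim x.1 x.2.1 = d} = ∅) ∧
    ∀ q : ℕ,
      {x : Σ q' : ℕ, (Fin q' → Finset (Fin n)) × (Fin (q' + 1) → Finset (Fin n)) |
        IsCrSeq {c : Cube (Fin n) | (starSet c).card ≤ s} x.1 x.2.1 x.2.2 ∧
          crDim x.1 x.2.1 = q * (s - 1)} =
      {x : Σ q' : ℕ, (Fin q' → Finset (Fin n)) × (Fin (q' + 1) → Finset (Fin n)) |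
        x.1 = q ∧
        (∀ y z : Fin x.1 ⊕ Fin (x.1 + 1), y ≠ z →
          Disjoint (Sum.elim x.2.1 x.2.2 y) (Sum.elim x.2.1 x.2.2 z)) ∧
        (∀ a : Fin n, (∃ j, a ∈ x.2.1 j) ∨ ∃ j, a ∈ x.2.2 j) ∧
        (∀ j : Fin x.1, (x.2.1 j).card = s + 1) ∧
        ∀ j : Fin x.1, x.2.2 j.castSucc = ∅ ∨
          (x.2.2 j.castSucc).max < (x.2.1 j).max} := by
  constructor
  · intro d hd
    refine Set.eq_empty_iff_forall_notMem.2 ?_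
    rintro ⟨q, E, F⟩ ⟨hcr, hdim⟩
    obtain ⟨-, -, hcard, -⟩ := (isCrSeq_skeleton_iff hs).1 hcr
    exact hd ⟨q, by rw [← hdim, crDim_of_card_eq hcard, mul_comm]⟩
  · intro q
    ext ⟨q', E, F⟩
    simp only [Set.mem_ofPred_eq, isCrSeq_skeleton_iff hs]
    constructor
    · rintro ⟨h, hdim⟩
      rw [crDim_of_card_eq h.2.2.1] at hdim
      exact ⟨Nat.eq_of_mul_eq_mul_right (by omega) hdim, h⟩
    · rintro ⟨rfl, h⟩
      exact ⟨h, crDim_of_card_eq h.2.2.1⟩
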